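/- Let φ : ℝ → ℝ be twice continuously differentiable with φ′(0) = 0 and 1 ≤ φ″(λ) ≤ C₀ for all λ ∈ ℝ. Then there is a constant C, depending only on C₀, such that for every t with |t| ≥ 1 and every continuously differentiable compactly supported a : ℝ → ℂ, |∫_{−∞}^{∞} e^{itφ(λ)} a(λ) dλ| ≤ C ( ∫_{|λ|<|t|^{−1/2}} |a(λ)| dλ + |t|^{−1} ∫_{|λ|>|t|^{−1/2}} ( |a(λ)|/λ² + |a′(λ)|/|λ| ) dλ ), whenever the integrals on the right-hand side are finite. -/

import Mathlib

open MeasureTheory Real Set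

noncomputable section

theorem norm_add_integral_Ioi_le {g F F' : ℝ → ℂ} {G : ℝ → ℝ} {r K : ℝ}
    (hF : ∀ x ∈ Ici r, HasDerivAt F (g x + F' x) x) (hlim : F =ᶠ[Filter.atTop] 0)
    (hg : IntegrableOn g (Ioi r)) (hG : IntegrableOn G (Ioi r))
    (hF'c : ContinuousOn F' (Ioi r)) (hF' : ∀ x ∈ Ioi r, ‖F' x‖ ≤ K * G x) :
    ‖(∫ x in Ioi r, g x) + F r‖ ≤ K * ∫ x in Ioi r, G x := by
  have hint : IntegrableOn F' (Ioi r) :=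
    (hG.const_mul K).mono' (hF'c.aestronglyMeasurable measurableSet_Ioi)
      ((ae_restrict_iff' measurableSet_Ioi).2 (.of_forall hF'))
  have h := integral_Ioi_of_hasDerivAt_of_tendsto' hF (hg.add hint)
    (m := 0) (tendsto_const_nhds.congr' hlim.symm)
  rw [integral_add hg hint] at h
  have h' : (∫ x in Ioi r, g x) + F r = -∫ x in Ioi r, F' x := by
    linear_combination h
  rw [h', norm_neg, ← integral_const_mul]
  exact norm_integral_le_of_norm_le (hG.const_mul K)
    ((ae_restrict_iff' measurableSet_Ioi).2 (.of_forall hF'))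

theorem norm_div_le_integral_Ioi {a : ℝ → ℂ} {r : ℝ} (hr : 0 < r) (ha : ContDiff ℝ 1 a)
    (hsupp : a =ᶠ[Filter.atTop] 0)
    (hG : IntegrableOn (fun l : ℝ => ‖a l‖ / l ^ 2 + ‖deriv a l‖ / |l|) (Ioi r)) :
    ‖a r‖ / r ≤ ∫ l in Ioi r, (‖a l‖ / l ^ 2 + ‖deriv a l‖ / |l|) := by
  have hda : ∀ x, HasDerivAt a (deriv a x) x := fun x =>
    (ha.differentiable one_ne_zero x).hasDerivAt
  have key := norm_add_integral_Ioi_le (F := fun x => a x / (x : ℂ)) (g := fun _ => 0)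
    (F' := fun x => deriv a x / (x : ℂ) - a x / (x : ℂ) ^ 2) (K := 1) (r := r)
    (fun x hx => by
      have hx0 : (x : ℂ) ≠ 0 := by exact_mod_cast (hr.trans_le hx).ne'
      refine ((hda x).fun_div (hasDerivAt_id x).ofReal_comp hx0).congr_deriv ?_
      simp only [id, Complex.ofReal_one]
      field_simp
      ring)
    (hsupp.mono fun x hx => by simp [hx]) integrableOn_zero hG
    (by
      have hne : ∀ x ∈ Ioi r, (x : ℂ) ≠ 0 := fun x hx => by
        exact_mod_cast (hr.trans hx).ne'
      have h1 := ha.continuous_deriv_one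
      have h2 := ha.continuous
      exact (h1.continuousOn.div (by fun_prop) hne).sub
        (h2.continuousOn.div (by fun_prop) fun x hx => pow_ne_zero 2 (hne x hx)))
    (fun x hx => by
      refine (norm_sub_le _ _).trans (le_of_eq ?_)
      simp only [norm_div, norm_pow, Complex.norm_real, Real.norm_eq_abs, sq_abs]
      ring)
  simpa [abs_of_pos hr] using key

theorem norm_integral_Ioi_exp_mul_le {C₀ t r : ℝ} (hC₀ : 1 ≤ C₀) (hr : 0 < r) (ht : t ≠ 0)
    {φ : ℝ → ℝ} (hφ : ContDiff ℝ 2 φ) (h0 : deriv φ 0 = 0)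
    (hφ2 : ∀ l : ℝ, 1 ≤ iteratedDeriv 2 φ l ∧ iteratedDeriv 2 φ l ≤ C₀)
    {a : ℝ → ℂ} (ha : ContDiff ℝ 1 a) (hs : HasCompactSupport a)
    (hG : IntegrableOn (fun l : ℝ => ‖a l‖ / l ^ 2 + ‖deriv a l‖ / |l|) (Ioi r)) :
    ‖∫ l in Ioi r, Complex.exp (Complex.I * (t : ℂ) * (φ l : ℂ)) * a l‖ ≤
      (C₀ + 1) * (|t|⁻¹ * ∫ l in Ioi r, (‖a l‖ / l ^ 2 + ‖deriv a l‖ / |l|)) := by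
  have hda : ∀ x, HasDerivAt a (deriv a x) x := fun x =>
    (ha.differentiable one_ne_zero x).hasDerivAt
  have hdφ : ∀ x, HasDerivAt φ (deriv φ x) x := fun x =>
    (hφ.differentiable two_ne_zero x).hasDerivAt
  have hφ1 : ContDiff ℝ 1 (deriv φ) := by
    have : ContDiff ℝ (1 + 1) φ := by simpa [one_add_one_eq_two] using hφ
    exact (contDiff_succ_iff_deriv.1 this).2.2
  have h2 : iteratedDeriv 2 φ = deriv (deriv φ) := by
    rw [iteratedDeriv_succ, iteratedDeriv_one]
  rw [h2] at hφ2
  have hdp : ∀ x, HasDerivAt (deriv φ) (deriv (deriv φ) x) x := fun x =>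
    (hφ1.differentiable one_ne_zero x).hasDerivAt
  have hp : ∀ x, 0 < x → x ≤ deriv φ x := fun x hx => by
    simpa [h0] using mul_sub_le_image_sub_of_le_deriv (hφ1.differentiable one_ne_zero)
      (fun y => (hφ2 y).1) hx.le
  have hp0 : ∀ x, 0 < x → 0 < deriv φ x := fun x hx => hx.trans_le (hp x hx)
  have hsupp : a =ᶠ[Filter.atTop] 0 := by
    have := hasCompactSupport_iff_eventuallyEq.1 hs
    exact this.filter_mono (by simp)
  have htC : (t : ℂ) ≠ 0 := by exact_mod_cast ht
  set e : ℝ → ℂ := fun l => Complex.exp (Complex.I * (t : ℂ) * (φ l : ℂ)) with he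
  have hnorm : ∀ x, ‖e x‖ = 1 := fun x => by
    simp [he, Complex.norm_exp]
  have hec : Continuous e := by
    have := hφ.continuous
    fun_prop
  have hde : ∀ x, HasDerivAt e (e x * (Complex.I * t * deriv φ x)) x := fun x =>
    ((hdφ x).ofReal_comp.const_mul (Complex.I * (t : ℂ))).cexp
  have hea : IntegrableOn (fun l => e l * a l) (Ioi r) :=
    ((hec.mul ha.continuous).integrable_of_hasCompactSupport hs.mul_left).integrableOn
  have hne : ∀ x ∈ Ioi r, Complex.I * t * ((deriv φ x : ℝ) : ℂ) ≠ 0 := fun x hx =>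
    mul_ne_zero (mul_ne_zero Complex.I_ne_zero htC)
      (by exact_mod_cast (hp0 x (hr.trans hx)).ne')
  have hne' : ∀ x ∈ Ioi r, Complex.I * t * ((deriv φ x : ℝ) : ℂ) ^ 2 ≠ 0 := fun x hx =>
    mul_ne_zero (mul_ne_zero Complex.I_ne_zero htC)
      (pow_ne_zero 2 (by exact_mod_cast (hp0 x (hr.trans hx)).ne'))
  have key := norm_add_integral_Ioi_le
    (F := fun x => e x * a x / (Complex.I * t * deriv φ x)) (g := fun l => e l * a l)
    (F' := fun x => e x * deriv a x / (Complex.I * t * deriv φ x) -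
      e x * a x * ((deriv (deriv φ) x : ℝ) : ℂ) / (Complex.I * t * ((deriv φ x : ℝ) : ℂ) ^ 2))
    (K := C₀ * |t|⁻¹) (r := r)
    (fun x hx => by
      have hx0 : ((deriv φ x : ℝ) : ℂ) ≠ 0 := by exact_mod_cast (hp0 x (hr.trans_le hx)).ne'
      refine (((hde x).fun_mul (hda x)).fun_div
        ((hdp x).ofReal_comp.const_mul (Complex.I * (t : ℂ)))
        (mul_ne_zero (mul_ne_zero Complex.I_ne_zero htC) hx0)).congr_deriv ?_
      field_simp
      ring)
    (hsupp.mono fun x hx => by simp [hx]) hea hG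
    (by
      have h1 := ha.continuous_deriv_one
      have h2 := ha.continuous
      have h3 := hφ1.continuous
      have h4 := hφ1.continuous_deriv_one
      exact ((hec.mul h1).continuousOn.div (by fun_prop) hne).sub
        (ContinuousOn.div (by fun_prop) (by fun_prop) hne'))
    (fun x hx => by
      have hx0 : 0 < x := hr.trans hx
      have hpx := hp x hx0
      have hq := hφ2 x
      refine (norm_sub_le _ _).trans ?_
      simp only [norm_div, norm_mul, norm_pow, Complex.norm_real, Real.norm_eq_abs, hnorm,
        Complex.norm_I, one_mul, abs_of_pos (hp0 x hx0), abs_of_pos hx0,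
        abs_of_pos (zero_lt_one.trans_le hq.1)]
      have b1 : ‖deriv a x‖ / (|t| * deriv φ x) ≤ C₀ * |t|⁻¹ * (‖deriv a x‖ / x) := by
        calc ‖deriv a x‖ / (|t| * deriv φ x) ≤ ‖deriv a x‖ / (|t| * x) := by gcongr
          _ = 1 * (|t|⁻¹ * (‖deriv a x‖ / x)) := by field_simp
          _ ≤ C₀ * (|t|⁻¹ * (‖deriv a x‖ / x)) := by gcongr
          _ = _ := by ring
      have b2 : ‖a x‖ * deriv (deriv φ) x / (|t| * deriv φ x ^ 2) ≤
          C₀ * |t|⁻¹ * (‖a x‖ / x ^ 2) := by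
        calc ‖a x‖ * deriv (deriv φ) x / (|t| * deriv φ x ^ 2)
            ≤ ‖a x‖ * C₀ / (|t| * x ^ 2) := by gcongr; exact hq.2
          _ = _ := by field_simp
      linarith)
  have hbd : ‖e r * a r / (Complex.I * t * deriv φ r)‖ ≤
      |t|⁻¹ * ∫ l in Ioi r, (‖a l‖ / l ^ 2 + ‖deriv a l‖ / |l|) := by
    simp only [norm_div, norm_mul, Complex.norm_real, Real.norm_eq_abs, hnorm,
      Complex.norm_I, one_mul, abs_of_pos (hp0 r hr)]
    calc ‖a r‖ / (|t| * deriv φ r) ≤ ‖a r‖ / (|t| * r) := by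
          gcongr
          exact hp r hr
      _ = |t|⁻¹ * (‖a r‖ / r) := by field_simp
      _ ≤ _ := by
          gcongr
          exact norm_div_le_integral_Ioi hr ha hsupp hG
  have htri := norm_sub_le ((∫ l in Ioi r, e l * a l) + e r * a r / (Complex.I * t * deriv φ r))
    (e r * a r / (Complex.I * t * deriv φ r))
  rw [add_sub_cancel_right] at htri
  linarith

/-- **A variant of stationary phase** (Lemma `stat phase` of the paper).
If `φ'(0) = 0` and `1 ≤ φ'' ≤ C₀`, then there is a constant `C = C(C₀)` so that for
`|t| ≥ 1` and any `C¹` compactly supported amplitude `a`,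
`|∫ e^{itφ(λ)} a(λ) dλ| ≲ ∫_{|λ|<|t|^{-1/2}} |a| + |t|⁻¹ ∫_{|λ|>|t|^{-1/2}} (|a|/λ² + |a'|/|λ|)`,
whenever the right-hand side integrals are finite. -/
theorem stationary_phase_estimate (C₀ : ℝ) :
    ∃ C : ℝ, 0 < C ∧
      ∀ φ : ℝ → ℝ, ContDiff ℝ 2 φ → deriv φ 0 = 0 →
        (∀ l : ℝ, 1 ≤ iteratedDeriv 2 φ l ∧ iteratedDeriv 2 φ l ≤ C₀) →
        ∀ t : ℝ, 1 ≤ |t| →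
          ∀ a : ℝ → ℂ, ContDiff ℝ 1 a → HasCompactSupport a →
            IntegrableOn (fun l : ℝ => ‖a l‖ / l ^ 2 + ‖deriv a l‖ / |l|)
              {l : ℝ | |t| ^ (-(1:ℝ)/2) < |l|} volume →
            ‖∫ l : ℝ, Complex.exp (Complex.I * (t : ℂ) * (φ l : ℂ)) * a l‖ ≤
              C * ((∫ l in {l : ℝ | |l| < |t| ^ (-(1:ℝ)/2)}, ‖a l‖) +
                |t|⁻¹ * ∫ l in {l : ℝ | |t| ^ (-(1:ℝ)/2) < |l|},
                  (‖a l‖ / l ^ 2 + ‖deriv a l‖ / |l|)) := by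
  refine ⟨|C₀| + 2, by positivity, ?_⟩
  intro φ hφ h0 hφ2 t ht a ha hs hG
  have hC₀ : 1 ≤ C₀ := (hφ2 0).1.trans (hφ2 0).2
  have ht0 : t ≠ 0 := by
    rintro rfl
    norm_num at ht
  set r := |t| ^ (-(1:ℝ)/2)
  have hr : 0 < r := by positivity
  have hout : {l : ℝ | r < |l|} = Iio (-r) ∪ Ioi r := by
    ext l
    simp only [mem_ofPred_eq, mem_union, mem_Iio, mem_Ioi, lt_abs]
    constructor <;> rintro (h | h) <;> first | (left; linarith) | (right; linarith)
  have hin : {l : ℝ | |l| < r} = Ioo (-r) r := by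
    ext l
    simp [abs_lt]
  have hdisj : Disjoint (Iio (-r)) (Ioi r) := by
    rw [Set.disjoint_left]
    intro x hx hx'
    simp only [mem_Iio, mem_Ioi] at hx hx'
    linarith
  rw [hout] at hG ⊢
  rw [hin]
  set e : ℝ → ℂ := fun l => Complex.exp (Complex.I * (t : ℂ) * (φ l : ℂ)) * a l with he
  set G : ℝ → ℝ := fun l => ‖a l‖ / l ^ 2 + ‖deriv a l‖ / |l| with hGdef
  have hGl : IntegrableOn G (Iio (-r)) := hG.left_of_union
  have hGr : IntegrableOn G (Ioi r) := hG.right_of_union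
  have hec : Continuous e := by
    have := hφ.continuous
    have := ha.continuous
    fun_prop
  have hei : Integrable e := hec.integrable_of_hasCompactSupport hs.mul_left
  have hright := norm_integral_Ioi_exp_mul_le hC₀ hr ht0 hφ h0 hφ2 ha hs hGr
  have hGneg : (fun l : ℝ => ‖a (-l)‖ / l ^ 2 + ‖deriv (fun x => a (-x)) l‖ / |l|) =
      fun l => G (-l) := by
    funext l
    simp [hGdef, deriv_comp_neg]
  have hleft := norm_integral_Ioi_exp_mul_le (φ := fun x => φ (-x)) (a := fun x => a (-x))
    hC₀ hr ht0 (hφ.comp contDiff_neg) (by simp [deriv_comp_neg, h0])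
    (fun l => by simpa [iteratedDeriv_comp_neg] using hφ2 (-l))
    (ha.comp contDiff_neg) (hs.comp_homeomorph (Homeomorph.neg ℝ))
    (by
      rw [hGneg]
      exact (integrableOn_Ici_iff_integrableOn_Ioi).1
        ((integrableOn_Iic_iff_integrableOn_Iio (by simp)).2 hGl).comp_neg_Ici)
  have hl1 := integral_comp_neg_Ioi r e
  have hl2 := integral_comp_neg_Ioi r G
  rw [hGneg, hl2, integral_Iic_eq_integral_Iio] at hleft
  change ‖∫ l in Ioi r, e (-l)‖ ≤ _ at hleft
  rw [hl1] at hleft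
  have hmid : ‖∫ l in Ioc (-r) r, e l‖ ≤ ∫ l in Ioo (-r) r, ‖a l‖ := by
    rw [integral_Ioc_eq_integral_Ioo]
    refine (norm_integral_le_integral_norm _).trans (le_of_eq ?_)
    simp [he, Complex.norm_exp]
  have hsplit : ∫ l, e l = (∫ l in Iic (-r), e l) + (∫ l in Ioc (-r) r, e l) +
      ∫ l in Ioi r, e l := by
    rw [← intervalIntegral.integral_Iic_add_Ioi hei.integrableOn hei.integrableOn (b := r),
      ← Iic_union_Ioc_eq_Iic (show -r ≤ r by linarith),
      setIntegral_union (Iic_disjoint_Ioc le_rfl) measurableSet_Ioc hei.integrableOn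
        hei.integrableOn]
  rw [hsplit, setIntegral_union hdisj measurableSet_Ioi hGl hGr, abs_of_pos (by linarith)]
  have hnn : 0 ≤ ∫ l in Ioo (-r) r, ‖a l‖ := integral_nonneg fun _ => norm_nonneg _
  have hGn : ∀ l, 0 ≤ G l := fun l => by positivity
  have hn1 : 0 ≤ |t|⁻¹ * ∫ l in Iio (-r), G l :=
    mul_nonneg (by positivity) (integral_nonneg hGn)
  have hn2 : 0 ≤ |t|⁻¹ * ∫ l in Ioi r, G l :=
    mul_nonneg (by positivity) (integral_nonneg hGn)
  have htri := norm_add₃_le (a := ∫ l in Iic (-r), e l) (b := ∫ l in Ioc (-r) r, e l)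
    (c := ∫ l in Ioi r, e l)
  have hmul := mul_nonneg (zero_le_one.trans hC₀) hnn
  linarith
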